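/- In the standing setting, with X ≠ {∞}, the polynomial entropy of f is bounded above by the maximal number of elements of a singular set: h_pol(f) ≤ sup { #S : S a nonempty finite singular subset of X∖{∞} }. -/

import Mathlib

open Filter Topology Set
open scoped ENNReal

/-- `E` is `(n, ε)`-separated for `f`: any two distinct points of `E` are `ε`-apart at some
time `k ∈ {0, …, n-1}`. -/
def IsDynSeparated {X : Type*} [MetricSpace X] (f : X → X) (n : ℕ) (ε : ℝ) (E : Set X) : Prop :=
  ∀ x ∈ E, ∀ y ∈ E, x ≠ y → ∃ k < n, ε < dist (f^[k] x) (f^[k] y)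

/-- `S(n, ε)`: the maximal cardinality of an `(n, ε)`-separated set. -/
noncomputable def maxSep {X : Type*} [MetricSpace X] (f : X → X) (n : ℕ) (ε : ℝ) : ℕ :=
  sSup {m | ∃ E : Finset X, IsDynSeparated f n ε ↑E ∧ E.card = m}

/-- Polynomial entropy `h_pol(f) = lim_{ε → 0} limsup_n (log S(n,ε) / log n)`, a value in
`[0, ∞]`.  Since `ε ↦ limsup_n (log S(n,ε) / log n)` is nonincreasing in `ε`, the limit as
`ε → 0⁺` is the supremum over `ε > 0`. -/
noncomputable def polEntropy {X : Type*} [MetricSpace X] (f : X → X) : ℝ≥0∞ :=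
  ⨆ (ε : ℝ) (_ : 0 < ε),
    Filter.atTop.limsup fun n : ℕ =>
      ENNReal.ofReal (Real.log (maxSep f n ε) / Real.log n)

/-- Topological entropy `h_top(f) = lim_{ε → 0} limsup_n (1/n) log S(n,ε)`. -/
noncomputable def topEntropy {X : Type*} [MetricSpace X] (f : X → X) : ℝ≥0∞ :=
  ⨆ (ε : ℝ) (_ : 0 < ε),
    Filter.atTop.limsup fun n : ℕ =>
      ENNReal.ofReal (Real.log (maxSep f n ε) / n)

/-- The set `A_n(ℱ)` of codings of orbit segments of length `n` relative to the finite
family `ℱ`: words `w` with letters in `ℱ ∪ {∞_ℱ}` (where `∞_ℱ` is the complement of `∪ℱ`)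
for which some orbit segment `(x, f x, …, f^{n-1} x)` satisfies `f^k x ∈ w k` for all `k`. -/
def codings {X : Type*} (f : X → X) (F : Finset (Set X)) (n : ℕ) : Set (Fin n → Set X) :=
  {w | (∀ k, w k ∈ F ∨ w k = (⋃₀ (F : Set (Set X)))ᶜ) ∧
      ∃ x : X, ∀ k : Fin n, f^[(k : ℕ)] x ∈ w k}

/-- Coding polynomial entropy of a finite family: `h_pol(f; ℱ) = limsup_n log #A_n(ℱ) / log n`.
For a single set `Y`, `h_pol(f; Y)` is `codingEntropy f {Y}`. -/
noncomputable def codingEntropy {X : Type*} (f : X → X) (F : Finset (Set X)) : ℝ≥0∞ :=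
  Filter.atTop.limsup fun n : ℕ =>
    ENNReal.ofReal (Real.log ((codings f F n).ncard) / Real.log n)

/-- The `n`-th iterate of a homeomorphism, for `n : ℤ`. -/
def zIter {X : Type*} [TopologicalSpace X] (f : X ≃ₜ X) (n : ℤ) (x : X) : X :=
  (f.toEquiv ^ n) x

/-- A set `Z` is wandering if `f^n(Z) ∩ Z = ∅` for every integer `n ≠ 0`. -/
def IsWanderingSet {X : Type*} [TopologicalSpace X] (f : X ≃ₜ X) (Z : Set X) : Prop :=
  ∀ n : ℤ, n ≠ 0 → zIter f n '' Z ∩ Z = ∅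

/-- Standing setting: `p` (the point written `∞` in the paper) is a fixed point of `f`, and
every other point is wandering, i.e. has a wandering neighborhood. -/
def StandingSetting {X : Type*} [TopologicalSpace X] (f : X ≃ₜ X) (p : X) : Prop :=
  f p = p ∧ ∀ x : X, x ≠ p → ∃ U ∈ 𝓝 x, IsWanderingSet f U

/-- `M(Y) = sup_{x ∈ X} #{n ∈ ℤ : f^n(x) ∈ Y}`. -/
noncomputable def orbitCount {X : Type*} [TopologicalSpace X] (f : X ≃ₜ X) (Y : Set X) : ℕ∞ :=
  ⨆ x : X, {n : ℤ | zIter f n x ∈ Y}.encard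

/-- Local polynomial entropy `h^loc_pol(f; S)` of a finite set `S`: the limit, along
decreasing neighborhood bases of the points of `S`, of the coding entropies of the
corresponding families of neighborhoods.  By monotonicity of the coding entropy this limit
equals the infimum of `h_pol(f; {U x : x ∈ S})` over all families `U` of respective
neighborhoods of the points of `S` such that `M(⋃_{x ∈ S} U x) < ∞` (such families exist,
and any decreasing neighborhood basis eventually consists of such sets). -/
noncomputable def localEntropy {X : Type*} [TopologicalSpace X] (f : X ≃ₜ X)
    (S : Finset X) : ℝ≥0∞ :=
  letI := Classical.decEq (Set X)
  ⨅ (U : X → Set X) (_ : ∀ x ∈ S, U x ∈ 𝓝 x)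
    (_ : orbitCount f (⋃ x ∈ S, U x) < ⊤),
    codingEntropy ⇑f (S.image U)

/-- The family `U` of sets (indexed by the points of `S`) is mutually singular: for every
`M` there are a point `x` and times `(N a)_{a ∈ S}` with `f^{N a}(x) ∈ U a` for all `a ∈ S`
and `|N a - N b| > M` for all `a ≠ b` in `S`. -/
def MutuallySingularFam {X : Type*} [TopologicalSpace X] (f : X ≃ₜ X) (S : Finset X)
    (U : X → Set X) : Prop :=
  ∀ M : ℕ, ∃ (x : X) (N : X → ℤ),
    (∀ a ∈ S, zIter f (N a) x ∈ U a) ∧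
    ∀ a ∈ S, ∀ b ∈ S, a ≠ b → (M : ℤ) < |N a - N b|

/-- A finite set `S` is singular if every family of respective neighborhoods of its points
is mutually singular. -/
def IsSingularSet {X : Type*} [TopologicalSpace X] (f : X ≃ₜ X) (S : Finset X) : Prop :=
  ∀ U : X → Set X, (∀ a ∈ S, U a ∈ 𝓝 a) → MutuallySingularFam f S U

theorem zIter_natCast {X : Type*} [TopologicalSpace X] (f : X ≃ₜ X) (n : ℕ) (x : X) :
    zIter f n x = f^[n] x := by
  simp only [zIter, zpow_natCast]
  rw [← Equiv.Perm.iterate_eq_pow]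
  rfl

theorem zIter_add {X : Type*} [TopologicalSpace X] (f : X ≃ₜ X) (m n : ℤ) (x : X) :
    zIter f (m + n) x = zIter f m (zIter f n x) := by
  simp only [zIter]
  rw [zpow_add, Equiv.Perm.mul_apply]

theorem continuous_zIter {X : Type*} [TopologicalSpace X] (f : X ≃ₜ X) (n : ℤ) :
    Continuous (zIter f n) := by
  obtain ⟨m, rfl | rfl⟩ := n.eq_nat_or_neg
  · have h : zIter f (m : ℤ) = f^[m] := funext (zIter_natCast f m)
    rw [h]
    exact f.continuous.iterate m
  · have h : zIter f (-(m : ℤ)) = f.symm^[m] := by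
      funext x
      simp only [zIter, zpow_neg, zpow_natCast, ← inv_pow]
      rw [← Equiv.Perm.iterate_eq_pow]
      rfl
    rw [h]
    exact f.symm.continuous.iterate m

/-- If no `L + 1` elements of `T` are pairwise more than `M` apart, then `L` intervals of
radius `M` centred in `{0, …, n - 1}` cover `T`. -/
theorem exists_centers_of_not_separated {n : ℕ} (hn : 0 < n) (M L : ℕ) (T : Finset ℕ)
    (hT : ∀ k ∈ T, k < n)
    (hsep : ∀ a : Fin (L + 1) → ℕ, (∀ i, a i ∈ T) →
      ∃ i j, i ≠ j ∧ |(a i : ℤ) - a j| ≤ M) :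
    ∃ t : Fin L → Fin n, ∀ k ∈ T, ∃ i, |(k : ℤ) - (t i : ℕ)| ≤ M := by
  induction L generalizing T with
  | zero =>
    refine ⟨Fin.elim0, fun k hk => ?_⟩
    obtain ⟨i, j, hij, -⟩ := hsep (fun _ => k) (fun _ => hk)
    exact absurd (Fin.ext (by omega)) hij
  | succ L ih =>
    rcases T.eq_empty_or_nonempty with rfl | hne
    · exact ⟨fun _ => ⟨0, hn⟩, by simp⟩
    have hm := T.min'_mem hne
    set m := T.min' hne
    have hmin : ∀ k ∈ T, m ≤ k := fun k hk => T.min'_le k hk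
    obtain ⟨t, ht⟩ := ih (T.filter (m + M < ·))
      (fun k hk => hT k (Finset.mem_filter.1 hk).1) (by
        intro a ha
        have ha' : ∀ i, a i ∈ T ∧ m + M < a i := fun i => Finset.mem_filter.1 (ha i)
        obtain ⟨i, j, hij, h⟩ := hsep (Fin.cons m a)
          (Fin.cases hm fun i => (ha' i).1)
        induction i using Fin.cases with
        | zero =>
          induction j using Fin.cases with
          | zero => exact absurd rfl hij
          | succ j =>
            have := (ha' j).2
            simp only [Fin.cons_zero, Fin.cons_succ, abs_le] at h
            omega
        | succ i =>
          induction j using Fin.cases with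
          | zero =>
            have := (ha' i).2
            simp only [Fin.cons_zero, Fin.cons_succ, abs_le] at h
            omega
          | succ j => exact ⟨i, j, fun h => hij (h ▸ rfl), by simpa using h⟩)
    refine ⟨Fin.cons ⟨m, hT m hm⟩ t, fun k hk => ?_⟩
    by_cases hkm : m + M < k
    · obtain ⟨i, hi⟩ := ht k (Finset.mem_filter.2 ⟨hk, hkm⟩)
      exact ⟨i.succ, by simpa using hi⟩
    · refine ⟨0, ?_⟩
      have := hmin k hk
      simp only [Fin.cons_zero, abs_le]
      omega

/-- If singular sets in the complement of `p` have at most `L` elements, then an orbit cannot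
leave the `ε`-ball around `p` at `L + 1` times that are too far apart. -/
theorem exists_gap_of_card_singular_le {X : Type*} [MetricSpace X] [CompactSpace X]
    (f : X ≃ₜ X) (p : X) (hst : StandingSetting f p) (L : ℕ)
    (hL : ∀ S : Finset X, S.Nonempty → (∀ a ∈ S, a ≠ p) → IsSingularSet f S → S.card ≤ L)
    {ε : ℝ} (hε : 0 < ε) :
    ∃ M : ℕ, ∀ (x : X) (a : Fin (L + 1) → ℤ), (∀ i, ε ≤ dist (zIter f (a i) x) p) →
      ∃ i j, i ≠ j ∧ |a i - a j| ≤ M := by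
  classical
  by_contra! hcon
  choose x a hfar hgap using hcon
  obtain ⟨z, φ, hφ, hz⟩ := CompactSpace.tendsto_subseq fun k i => zIter f (a k i) (x k)
  have hz' : ∀ i, Tendsto (fun k => zIter f (a (φ k) i) (x (φ k))) atTop (𝓝 (z i)) :=
    fun i => (tendsto_pi_nhds.1 hz) i
  have hzp : ∀ i, z i ≠ p := by
    intro i hi
    have h := ge_of_tendsto ((hz' i).dist (tendsto_const_nhds (x := p)))
      (Eventually.of_forall fun k => hfar (φ k) i)
    rw [hi, dist_self] at h
    linarith
  have hinj : Function.Injective z := by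
    intro i j hij
    by_contra hne
    obtain ⟨U, hU, hw⟩ := hst.2 (z i) (hzp i)
    obtain ⟨k, hki, hkj⟩ :=
      (((hz' i).eventually_mem hU).and ((hz' j).eventually_mem (hij ▸ hU))).exists
    have hd : a (φ k) j - a (φ k) i ≠ 0 := by
      intro h0
      have h := hgap (φ k) j i (Ne.symm hne)
      rw [h0, abs_zero] at h
      omega
    have hmem : zIter f (a (φ k) j) (x (φ k)) ∈
        zIter f (a (φ k) j - a (φ k) i) '' U ∩ U := by
      refine ⟨⟨_, hki, ?_⟩, hkj⟩
      rw [← zIter_add, sub_add_cancel]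
    rw [hw _ hd] at hmem
    exact hmem
  have hsing : IsSingularSet f (Finset.univ.image z) := by
    intro U hU M
    have hev : ∀ᶠ k in atTop, ∀ i, zIter f (a (φ k) i) (x (φ k)) ∈ U (z i) :=
      eventually_all.2 fun i =>
        (hz' i).eventually_mem (hU _ (Finset.mem_image_of_mem z (Finset.mem_univ i)))
    obtain ⟨k, hk, hMk⟩ := (hev.and (eventually_ge_atTop M)).exists
    have hleft := Function.leftInverse_invFun hinj
    refine ⟨x (φ k), fun b => a (φ k) (Function.invFun z b), ?_, ?_⟩
    · intro b hb
      obtain ⟨i, -, rfl⟩ := Finset.mem_image.1 hb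
      simpa only [hleft i] using hk i
    · intro b hb c hc hbc
      obtain ⟨i, -, rfl⟩ := Finset.mem_image.1 hb
      obtain ⟨j, -, rfl⟩ := Finset.mem_image.1 hc
      simp only [hleft i, hleft j]
      have h := hgap (φ k) i j fun h => hbc (h ▸ rfl)
      have := hφ.id_le k
      simp only [id] at this
      omega
  have h := hL (Finset.univ.image z) (Finset.univ_nonempty.image z)
    (by simpa using hzp) hsing
  rw [Finset.card_image_of_injective _ hinj, Finset.card_univ, Fintype.card_fin] at h
  omega

/-- A finite colouring such that points of the same colour stay `ε`-close for all times
in `{-M, …, M}`. -/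
theorem exists_coloring {X : Type*} [MetricSpace X] [CompactSpace X] (f : X ≃ₜ X) (M : ℕ)
    {ε : ℝ} (hε : 0 < ε) :
    ∃ (t : Finset X) (c : X → t), ∀ x y, c x = c y →
      ∀ j : ℤ, |j| ≤ M → dist (zIter f j x) (zIter f j y) ≤ ε := by
  obtain ⟨t, ht⟩ := CompactSpace.elim_nhds_subcover
    (fun a => {b | ∀ j ∈ Finset.Icc (-(M : ℤ)) M, dist (zIter f j b) (zIter f j a) < ε / 2})
    (fun a => by
      refine (eventually_all_finset _).2 fun j _ => ?_
      have h := ((continuous_zIter f j).tendsto a).dist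
        (tendsto_const_nhds (x := zIter f j a))
      rw [dist_self] at h
      exact h.eventually_lt_const (half_pos hε))
  have hcov : ∀ x, ∃ a : t, ∀ j ∈ Finset.Icc (-(M : ℤ)) M,
      dist (zIter f j x) (zIter f j a) < ε / 2 := by
    intro x
    have hx : x ∈ (⊤ : Set X) := mem_univ x
    rw [← ht] at hx
    obtain ⟨a, ha, h⟩ := mem_iUnion₂.1 hx
    exact ⟨⟨a, ha⟩, h⟩
  choose c hc using hcov
  refine ⟨t, c, fun x y hxy j hj => ?_⟩
  have hj' : j ∈ Finset.Icc (-(M : ℤ)) M := Finset.mem_Icc.2 (abs_le.1 hj)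
  have h1 := hc x j hj'
  have h2 := hc y j hj'
  rw [← hxy] at h2
  have := dist_triangle_right (zIter f j x) (zIter f j y) (zIter f j (c x))
  linarith

/-- If singular sets in the complement of `p` have at most `L` elements, then `S(n, ε)` grows
at most like `n ^ L`. -/
theorem exists_maxSep_le {X : Type*} [MetricSpace X] [CompactSpace X]
    (f : X ≃ₜ X) (p : X) (hst : StandingSetting f p) (L : ℕ)
    (hL : ∀ S : Finset X, S.Nonempty → (∀ a ∈ S, a ≠ p) → IsSingularSet f S → S.card ≤ L)
    {ε : ℝ} (hε : 0 < ε) :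
    ∃ C : ℕ, 0 < C ∧ ∀ n, 0 < n → maxSep f n ε ≤ (n * C) ^ L := by
  classical
  obtain ⟨M, hM⟩ := exists_gap_of_card_singular_le f p hst L hL (half_pos hε)
  obtain ⟨t, c, hc⟩ := exists_coloring f M hε
  refine ⟨t.card, Finset.card_pos.2 ⟨c p, (c p).2⟩, fun n hn => csSup_le' ?_⟩
  rintro _ ⟨E, hE, rfl⟩
  have hcen : ∀ x : X, ∃ s : Fin L → Fin n, ∀ k < n, ε / 2 ≤ dist (f^[k] x) p →
      ∃ i, |(k : ℤ) - (s i : ℕ)| ≤ M := by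
    intro x
    obtain ⟨s, hs⟩ := exists_centers_of_not_separated hn M L
      ((Finset.range n).filter fun k => ε / 2 ≤ dist (f^[k] x) p)
      (fun k hk => Finset.mem_range.1 (Finset.mem_filter.1 hk).1)
      (fun a ha => hM x (fun i => a i) fun i => by
        rw [zIter_natCast]
        exact (Finset.mem_filter.1 (ha i)).2)
    exact ⟨s, fun k hk h => hs k (Finset.mem_filter.2 ⟨Finset.mem_range.2 hk, h⟩)⟩
  choose s hs using hcen
  let code : X → Fin L → Fin n × t := fun x i => (s x i, c (f^[s x i] x))
  have hclose : ∀ x y, code x = code y → ∀ k < n, ε / 2 ≤ dist (f^[k] x) p →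
      dist (f^[k] x) (f^[k] y) ≤ ε := by
    intro x y hxy k hk hfar
    obtain ⟨i, hi⟩ := hs x k hk hfar
    have hcode := congrFun hxy i
    have h1 : s x i = s y i := congrArg Prod.fst hcode
    have h2 : c (f^[s x i] x) = c (f^[s y i] y) := congrArg Prod.snd hcode
    rw [← h1] at h2
    have h := hc _ _ h2 _ hi
    simpa only [← zIter_natCast, ← zIter_add, sub_add_cancel] using h
  have hinj : Set.InjOn code E := by
    intro x hx y hy hxy
    by_contra hne
    obtain ⟨k, hk, hd⟩ := hE x hx y hy hne
    by_cases h1 : ε / 2 ≤ dist (f^[k] x) p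
    · exact (hclose x y hxy k hk h1).not_gt hd
    by_cases h2 : ε / 2 ≤ dist (f^[k] y) p
    · rw [dist_comm] at hd
      exact (hclose y x hxy.symm k hk h2).not_gt hd
    · have := dist_triangle_right (f^[k] x) (f^[k] y) p
      linarith
  calc E.card = (E.image code).card := (Finset.card_image_of_injOn hinj).symm
    _ ≤ Fintype.card (Fin L → Fin n × t) := Finset.card_le_univ _
    _ = (n * t.card) ^ L := by simp

theorem limsup_log_div_log_le {u : ℕ → ℕ} {C L : ℕ} (hC : 0 < C)
    (hu : ∀ n, 0 < n → u n ≤ (n * C) ^ L) :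
    atTop.limsup (fun n : ℕ => ENNReal.ofReal (Real.log (u n) / Real.log n)) ≤ L := by
  have hlim : Tendsto (fun n : ℕ => ENNReal.ofReal (L + L * Real.log C / Real.log n)) atTop
      (𝓝 L) := by
    have h : Tendsto (fun n : ℕ => (L : ℝ) + L * Real.log C / Real.log n) atTop (𝓝 (L + 0)) :=
      tendsto_const_nhds.add (tendsto_const_nhds.div_atTop
        (Real.tendsto_log_atTop.comp tendsto_natCast_atTop_atTop))
    simpa using ENNReal.tendsto_ofReal h
  refine (limsup_le_limsup ?_).trans_eq hlim.limsup_eq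
  filter_upwards [eventually_ge_atTop 2] with n hn
  refine ENNReal.ofReal_le_ofReal ?_
  have hn' : (1 : ℝ) < n := by exact_mod_cast hn
  have hlog : 0 < Real.log n := Real.log_pos hn'
  have hCpos : (0 : ℝ) < C := by exact_mod_cast hC
  have hC' : 0 ≤ Real.log C := Real.log_natCast_nonneg C
  have key : Real.log (u n) ≤ L * (Real.log n + Real.log C) := by
    rcases Nat.eq_zero_or_pos (u n) with h0 | hpos
    · rw [h0, Nat.cast_zero, Real.log_zero]
      positivity
    · have h : (u n : ℝ) ≤ ((n : ℝ) * C) ^ L := by exact_mod_cast hu n (by omega)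
      have h' := Real.log_le_log (by exact_mod_cast hpos) h
      rwa [Real.log_pow, Real.log_mul (by positivity) hCpos.ne'] at h'
  rw [div_le_iff₀ hlog, add_mul, div_mul_cancel₀ _ hlog.ne']
  linarith

/-- `h_pol(f)` is bounded above by the maximal number of elements of a
(nonempty finite) singular subset of `X ∖ {∞}`, provided `X ≠ {∞}`. -/
theorem polEntropy_le_sup_card_singular {X : Type*} [MetricSpace X] [CompactSpace X]
    (f : X ≃ₜ X) (p : X) (hst : StandingSetting f p)
    (hne : ∃ x : X, x ≠ p) :
    polEntropy ⇑f ≤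
      ⨆ (S : Finset X) (_ : S.Nonempty ∧ (∀ a ∈ S, a ≠ p) ∧ IsSingularSet f S),
        (S.card : ℝ≥0∞) := by
  set s : ℝ≥0∞ := ⨆ (S : Finset X) (_ : S.Nonempty ∧ (∀ a ∈ S, a ≠ p) ∧ IsSingularSet f S),
    (S.card : ℝ≥0∞)
  rcases eq_or_ne s ⊤ with htop | htop
  · exact htop ▸ le_top
  obtain ⟨L, hL1, hL2⟩ : ∃ L : ℕ, (L : ℝ≥0∞) ≤ s ∧ s < (L + 1 : ℕ) := by
    rw [← ENNReal.coe_toNNReal htop]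
    refine ⟨⌊s.toNNReal⌋₊, ?_, ?_⟩
    · exact_mod_cast Nat.floor_le s.toNNReal.2
    · exact_mod_cast Nat.lt_floor_add_one s.toNNReal
  have hL : ∀ S : Finset X, S.Nonempty → (∀ a ∈ S, a ≠ p) → IsSingularSet f S →
      S.card ≤ L := by
    intro S h1 h2 h3
    have h : (S.card : ℝ≥0∞) ≤ s := le_iSup₂_of_le S ⟨h1, h2, h3⟩ le_rfl
    have h' : S.card < L + 1 := by exact_mod_cast h.trans_lt hL2
    omega
  refine le_trans (iSup₂_le fun ε hε => ?_) hL1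
  obtain ⟨C, hC, hle⟩ := exists_maxSep_le f p hst L hL hε
  exact limsup_log_div_log_le hC hle
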